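/- arXiv:0901.2838 — 10 statements merged into one kernel-verified Lean document; each statement's English description precedes it below -/
import Mathlib

section
/- For all y > 0, the sum Σ_{j=1}^{d−1} δ_{l,r_j}(y) equals G_d(y)·( (b−1)·ε·ε̃/y + ε̃·x ) + b·ε·ε̃. -/
open Finset Filter

/-- `x(y) = ε·y^(b−1)`. -/
noncomputable def xx (b : ℕ) (ε y : ℝ) : ℝ := ε * y ^ (b - 1)

/-- `G_j(y) = C(d−1,j−1)·x^(j−1)·x̃^(d−j−1)·(d·x − j) + 1_{j=1}` for `j ∈ {1,…,d−1}`. -/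
noncomputable def G (b d : ℕ) (ε : ℝ) (j : ℕ) (y : ℝ) : ℝ :=
  (Nat.choose (d - 1) (j - 1) : ℝ) * xx b ε y ^ (j - 1) *
      (1 - xx b ε y) ^ (d - j - 1) * ((d : ℝ) * xx b ε y - (j : ℝ)) +
    (if j = 1 then (1 : ℝ) else 0)

/-- `G_d(y) = −d·x^(d−1)`. -/
noncomputable def Gd (b d : ℕ) (ε y : ℝ) : ℝ := -(d : ℝ) * xx b ε y ^ (d - 1)

/-- `δ_{l,r_j}(y) = −G_j(y)·(ε·ε̃·(b−1)/y + ε̃·x) + 1_{j=1}·b·ε·ε̃`. -/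
noncomputable def dlr (b d : ℕ) (ε : ℝ) (j : ℕ) (y : ℝ) : ℝ :=
  -(G b d ε j y) * (ε * (1 - ε) * ((b : ℝ) - 1) / y + (1 - ε) * xx b ε y) +
    (if j = 1 then (1 : ℝ) else 0) * ((b : ℝ) * ε * (1 - ε))

/-- Each term is a difference of weighted Bernstein polynomials, so that the sum telescopes up to
the binomial expansion of `(x + (1 - x)) ^ n`. -/
theorem sum_range_choose_mul_pow_mul_sub {R : Type*} [CommRing R] (n : ℕ) (x : R) :
    ∑ k ∈ Finset.range n,
      (n.choose k : R) * x ^ k * (1 - x) ^ (n - k - 1) * ((n + 1) * x - (k + 1)) =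
      (n + 1) * x ^ n - 1 := by
  set A : ℕ → R := fun k ↦ x ^ k * (1 - x) ^ (n - k) * (n.choose k : R) with hA
  have hterm : ∀ k ∈ Finset.range n,
      (n.choose k : R) * x ^ k * (1 - x) ^ (n - k - 1) * ((n + 1) * x - (k + 1)) =
        (((k + 1 : ℕ) : R) * A (k + 1) - (k : R) * A k) - A k := by
    intro k hk
    obtain ⟨m, rfl⟩ := Nat.exists_eq_add_of_lt (Finset.mem_range.mp hk)
    have hchoose : ((k + m + 1).choose (k + 1) : R) * (k + 1) =
        ((k + m + 1).choose k : R) * (m + 1) := by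
      have h := Nat.choose_succ_right_eq (k + m + 1) k
      rw [show k + m + 1 - k = m + 1 by omega] at h
      exact_mod_cast congrArg (Nat.cast : ℕ → R) h
    simp only [hA, show k + m + 1 - k = m + 1 by omega,
      show k + m + 1 - (k + 1) = m by omega, Nat.add_sub_cancel]
    push_cast
    linear_combination -(x ^ (k + 1) * (1 - x) ^ m) * hchoose
  have hbinom : ∑ k ∈ Finset.range (n + 1), A k = 1 := by
    simpa [hA] using (add_pow x (1 - x) n).symm
  have hlast : A n = x ^ n := by simp [hA]
  rw [Finset.sum_range_succ, hlast] at hbinom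
  rw [Finset.sum_congr rfl hterm, Finset.sum_sub_distrib,
    Finset.sum_range_sub (fun k ↦ (k : R) * A k), hlast]
  push_cast
  linear_combination -hbinom

theorem sum_Icc_ite_eq_one {d : ℕ} (hd : 2 ≤ d) :
    ∑ j ∈ Finset.Icc 1 (d - 1), (if j = 1 then (1 : ℝ) else 0) = 1 := by
  rw [Finset.sum_ite_eq', if_pos (Finset.mem_Icc.mpr ⟨le_rfl, by omega⟩)]

theorem sum_G_eq_neg_Gd (b : ℕ) {d : ℕ} (hd : 2 ≤ d) (ε y : ℝ) :
    ∑ j ∈ Finset.Icc 1 (d - 1), G b d ε j y = -Gd b d ε y := by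
  simp only [G, Gd]
  rw [Finset.sum_add_distrib, sum_Icc_ite_eq_one hd]
  obtain ⟨n, rfl⟩ : ∃ n, d = n + 1 := ⟨d - 1, by omega⟩
  have h := sum_range_choose_mul_pow_mul_sub n (xx b ε y)
  rw [Nat.add_sub_cancel, ← Finset.Ico_add_one_right_eq_Icc, Finset.sum_Ico_eq_sum_range,
    Nat.add_sub_cancel]
  have hcongr : ∀ k, n + 1 - (1 + k) - 1 = n - k - 1 := fun k ↦ by omega
  simp only [hcongr, Nat.add_sub_cancel_left, Nat.cast_add, Nat.cast_one, add_comm (1 : ℝ)]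
  rw [h]
  ring

/-- For all `y > 0`,
`Σ_{j=1}^{d−1} δ_{l,r_j}(y) = G_d(y)·((b−1)·ε·ε̃/y + ε̃·x) + b·ε·ε̃`. -/
theorem sum_dlr_eq (b d : ℕ) (hb : 2 ≤ b) (hd : 2 ≤ d) (ε : ℝ) (hε0 : 0 < ε) (hε1 : ε < 1)
    (y : ℝ) (hy : 0 < y) :
    ∑ j ∈ Finset.Icc 1 (d - 1), dlr b d ε j y =
      Gd b d ε y * (((b : ℝ) - 1) * ε * (1 - ε) / y + (1 - ε) * xx b ε y) +
        (b : ℝ) * ε * (1 - ε) := by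
  simp only [dlr]
  rw [Finset.sum_add_distrib, ← Finset.sum_mul, ← Finset.sum_mul, Finset.sum_neg_distrib,
    sum_G_eq_neg_Gd b hd, sum_Icc_ite_eq_one hd]
  ring
end

section
/- For every integer j with 1 ≤ j ≤ d−2 and every y > 0, the derivative identity d/dy [ y^(−j(b−1)) · ( −ε̃·x·G_j(y) + (d/(d−j−1))·C(d−1,j−1)·ε̃·x^j ) ] = (b−1)·j·ε̃·x·G_{j+1}(y)·y^(−j(b−1)−1) holds. -/
open Finset Filter

theorem hasDerivAt_one_sub_pow_mul (n : ℕ) (d j u : ℝ) (hd : d = j + n + 2) :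
    HasDerivAt (fun x : ℝ => (1 - x) ^ (n + 1) * (d * x - j))
      (-((n + 2 : ℝ) * (1 - u) ^ n * (d * u - (j + 1)))) u := by
  have h := (((hasDerivAt_id u).const_sub 1).pow (n + 1)).mul
    (((hasDerivAt_id u).const_mul d).sub_const j)
  refine h.congr_deriv ?_
  subst hd
  simp only [id, Nat.add_sub_cancel, Pi.pow_apply]
  push_cast
  ring

theorem hasDerivAt_xx (m : ℕ) (ε y : ℝ) (hy : y ≠ 0) :
    HasDerivAt (xx (m + 1) ε) (m * xx (m + 1) ε y / y) y := by
  have h := (hasDerivAt_pow m y).const_mul ε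
  refine h.congr_deriv ?_
  rcases m with _ | m
  · simp
  · simp only [xx, Nat.add_sub_cancel]
    field_simp
    ring

theorem xx_pow_div (m j : ℕ) (ε t : ℝ) (ht : t ≠ 0) :
    xx (m + 1) ε t ^ j / t ^ (j * m) = ε ^ j := by
  rw [xx, Nat.add_sub_cancel, mul_pow, ← pow_mul, mul_comm m j,
    mul_div_cancel_right₀ _ (pow_ne_zero _ ht)]

/-- For `1 ≤ j ≤ d−2` and `y > 0`,
`d/dy [ y^(−j(b−1))·( −ε̃·x·G_j(y) + (d/(d−j−1))·C(d−1,j−1)·ε̃·x^j ) ]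
  = (b−1)·j·ε̃·x·G_{j+1}(y)·y^(−j(b−1)−1)`. -/
theorem deriv_identity_Gj (b d : ℕ) (hb : 2 ≤ b) (hd : 2 ≤ d) (ε : ℝ)
    (hε0 : 0 < ε) (hε1 : ε < 1) (j : ℕ) (hj1 : 1 ≤ j) (hj2 : j ≤ d - 2)
    (y : ℝ) (hy : 0 < y) :
    HasDerivAt
      (fun t =>
        (-((1 - ε) * xx b ε t * G b d ε j t) +
            ((d : ℝ) / ((d : ℝ) - (j : ℝ) - 1)) * (Nat.choose (d - 1) (j - 1) : ℝ) *
              (1 - ε) * xx b ε t ^ j) / t ^ (j * (b - 1)))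
      (((b : ℝ) - 1) * (j : ℝ) * (1 - ε) * xx b ε y * G b d ε (j + 1) y /
        y ^ (j * (b - 1) + 1)) y := by
  obtain ⟨k, rfl⟩ : ∃ k, j = k + 1 := ⟨j - 1, by omega⟩
  obtain ⟨n, rfl⟩ : ∃ n, d = k + n + 3 := ⟨d - k - 3, by omega⟩
  obtain ⟨m, rfl⟩ : ∃ m, b = m + 1 := ⟨b - 1, by omega⟩
  have hchoose : ((k + n + 2).choose (k + 1) : ℝ) * (k + 1) =
      (k + n + 2).choose k * (n + 2) := by
    have h := Nat.choose_succ_right_eq (k + n + 2) k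
    rw [show k + n + 2 - k = n + 2 by omega] at h
    exact_mod_cast h
  have hx := hasDerivAt_xx m ε y hy.ne'
  have hcomp := (hasDerivAt_one_sub_pow_mul n ((k + n + 3 : ℕ) : ℝ) ((k + 1 : ℕ) : ℝ)
    (xx (m + 1) ε y) (by push_cast; ring)).comp y hx
  set D : ℝ := ((k + n + 3 : ℕ) : ℝ) / (((k + n + 3 : ℕ) : ℝ) - ((k + 1 : ℕ) : ℝ) - 1)
  have hmain := (hcomp.const_mul
    (-((1 - ε) * ((k + n + 2).choose k : ℝ) * ε ^ (k + 1)))).add_const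
      (D * ((k + n + 2).choose k : ℝ) * (1 - ε) * ε ^ (k + 1) -
        (1 - ε) * (if k = 0 then ε else 0))
  have hG : ∀ t, G (m + 1) (k + n + 3) ε (k + 1) t =
      ((k + n + 2).choose k : ℝ) * xx (m + 1) ε t ^ k * (1 - xx (m + 1) ε t) ^ (n + 1) *
        (((k + n + 3 : ℕ) : ℝ) * xx (m + 1) ε t - ((k + 1 : ℕ) : ℝ)) +
          (if k = 0 then 1 else 0) := by
    intro t
    rw [G, show k + n + 3 - (k + 1) - 1 = n + 1 by omega]
    simp
  have hG' : G (m + 1) (k + n + 3) ε (k + 1 + 1) y =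
      ((k + n + 2).choose (k + 1) : ℝ) * xx (m + 1) ε y ^ (k + 1) *
        (1 - xx (m + 1) ε y) ^ n *
        (((k + n + 3 : ℕ) : ℝ) * xx (m + 1) ε y - (((k + 1 : ℕ) : ℝ) + 1)) := by
    rw [G, show k + n + 3 - (k + 1 + 1) - 1 = n by omega]
    simp
  refine (hmain.congr_of_eventuallyEq ?_).congr_deriv ?_
  · filter_upwards [lt_mem_nhds hy] with t ht
    have hpow := xx_pow_div m (k + 1) ε t ht.ne'
    have hone : (if k = 0 then xx (m + 1) ε t else 0) / t ^ ((k + 1) * m) =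
        if k = 0 then ε else 0 := by
      split_ifs with hk
      · subst hk
        simpa using hpow
      · simp
    have hite : xx (m + 1) ε t * (if k = 0 then (1 : ℝ) else 0) =
        if k = 0 then xx (m + 1) ε t else 0 := by
      simp
    rw [hG t, ← hone, ← hpow, ← hite]
    simp only [Nat.add_sub_cancel, Function.comp_apply,
      show k + n + 3 - 1 = k + n + 2 from rfl]
    ring
  · rw [hG', ← xx_pow_div m (k + 1) ε y hy.ne', Nat.add_sub_cancel, pow_succ y]
    push_cast at hchoose ⊢
    linear_combination (-(m * (1 - ε) * xx (m + 1) ε y * xx (m + 1) ε y ^ (k + 1) *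
      (1 - xx (m + 1) ε y) ^ n * ((k + n + 3) * xx (m + 1) ε y - (k + 1 + 1)) /
        (y ^ ((k + 1) * m) * y))) * hchoose
end

section
/- For all y > 0, the double sum Σ_{k=1}^{d−1} Σ_{j=1}^{d−1} δ_{r_k,r_j}(y) equals ((b−1)/b)·G_d(y)²·( (b−1)·ε·ε̃/y² − (ε−ε̃)·x/y + x² ) + 2·G_d(y)·( (b−1)·ε·ε̃/y + ε̃·x ) + d·x^d − d·x^(2d) + b·ε·ε̃. -/
open Finset Filter

/-- `δ_{r_k,r_j}(y)` as in Theorem 1. -/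
noncomputable def drr (b d : ℕ) (ε : ℝ) (k j : ℕ) (y : ℝ) : ℝ :=
  (((b : ℝ) - 1) / (b : ℝ)) * G b d ε k y * G b d ε j y *
      (ε * (1 - ε) * ((b : ℝ) - 1) / y ^ 2 - (ε - (1 - ε)) * xx b ε y / y + xx b ε y ^ 2)
    - (d : ℝ) * (Nat.choose (d - 1) (k - 1) : ℝ) * (Nat.choose (d - 1) (j - 1) : ℝ) *
        xx b ε y ^ (k + j) * (1 - xx b ε y) ^ (2 * d - k - j)
    + (if k = j then (1 : ℝ) else 0) * (k : ℝ) * (Nat.choose (d - 1) (k - 1) : ℝ) *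
        xx b ε y ^ k * (1 - xx b ε y) ^ (d - k)
    + (if k = 1 ∧ j = 1 then (1 : ℝ) else 0) *
        ((b : ℝ) * ε * (1 - ε) - xx b ε y * (1 - xx b ε y))
    - ((if k = 1 then (1 : ℝ) else 0) * G b d ε j y +
        (if j = 1 then (1 : ℝ) else 0) * G b d ε k y) *
        (ε * (1 - ε) * ((b : ℝ) - 1) / y - ε * xx b ε y + xx b ε y ^ 2)

/-- The Bernstein weights below the top index sum to `1 - x ^ n`. -/
theorem sum_range_bernstein_weight (n : ℕ) (x : ℝ) :
    ∑ m ∈ range n, (n.choose m : ℝ) * x ^ m * (1 - x) ^ (n - m) = 1 - x ^ n := by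
  have h := congrArg (Polynomial.eval x) (bernsteinPolynomial.sum ℝ n)
  simp only [sum_range_succ, bernsteinPolynomial, Polynomial.eval_add,
    Polynomial.eval_finsetSum, Polynomial.eval_mul,
    Polynomial.eval_pow, Polynomial.eval_sub, Polynomial.eval_natCast, Polynomial.eval_X,
    Polynomial.eval_one, Nat.choose_self, Nat.sub_self, pow_zero,
    Nat.cast_one] at h
  linarith

/-- The mean of the Bernstein weights below the top index. -/
theorem sum_range_mul_bernstein_weight (n : ℕ) (x : ℝ) :
    ∑ m ∈ range n, (m : ℝ) * ((n.choose m : ℝ) * x ^ m * (1 - x) ^ (n - m)) =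
      n * x - n * x ^ n := by
  have h := congrArg (Polynomial.eval x) (bernsteinPolynomial.sum_smul ℝ n)
  simp only [sum_range_succ, bernsteinPolynomial, Polynomial.eval_add,
    Polynomial.eval_finsetSum, Polynomial.eval_mul,
    Polynomial.eval_pow, Polynomial.eval_sub, Polynomial.eval_natCast, Polynomial.eval_X,
    Polynomial.eval_one, Nat.choose_self, Nat.sub_self, pow_zero,
    Nat.cast_one, nsmul_eq_mul] at h
  linarith

theorem sum_Icc_one_eq_sum_range (n : ℕ) (f : ℕ → ℝ) :
    ∑ k ∈ Icc 1 n, f k = ∑ m ∈ range n, f (m + 1) := by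
  rw [range_eq_Ico, sum_Ico_add' f 0 n 1]
  rfl

theorem sum_choose_mul_pow (n : ℕ) (x : ℝ) :
    ∑ k ∈ Icc 1 n, (n.choose (k - 1) : ℝ) * x ^ k * (1 - x) ^ (n + 1 - k) =
      x - x ^ (n + 1) := by
  rw [sum_Icc_one_eq_sum_range,
    show x - x ^ (n + 1) = x * (1 - x ^ n) by ring, ← sum_range_bernstein_weight, mul_sum]
  refine sum_congr rfl fun m _ => ?_
  rw [Nat.add_sub_cancel, Nat.add_sub_add_right]
  ring

theorem sum_mul_choose_mul_pow (n : ℕ) (x : ℝ) :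
    ∑ k ∈ Icc 1 n, (k : ℝ) * (n.choose (k - 1) : ℝ) * x ^ k * (1 - x) ^ (n + 1 - k) =
      x + n * x ^ 2 - (n + 1) * x ^ (n + 1) := by
  rw [sum_Icc_one_eq_sum_range,
    show x + n * x ^ 2 - (n + 1) * x ^ (n + 1) = x * ((n * x - n * x ^ n) + (1 - x ^ n)) by ring,
    ← sum_range_bernstein_weight, ← sum_range_mul_bernstein_weight, ← sum_add_distrib, mul_sum]
  refine sum_congr rfl fun m _ => ?_
  rw [Nat.add_sub_cancel, Nat.add_sub_add_right]
  push_cast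
  ring

/-- The functions `G_1, …, G_d` sum to zero. -/
theorem sum_G (b n : ℕ) (hn : 1 ≤ n) (ε y : ℝ) :
    ∑ k ∈ Icc 1 n, G b (n + 1) ε k y = -Gd b (n + 1) ε y := by
  simp only [G, Gd, Nat.add_sub_cancel]
  rw [sum_add_distrib, sum_ite_eq' (Icc 1 n) 1, if_pos (mem_Icc.2 ⟨le_rfl, hn⟩),
    sum_Icc_one_eq_sum_range]
  generalize xx b ε y = x
  have key : ∀ m ∈ range n, (n.choose (m + 1 - 1) : ℝ) * x ^ (m + 1 - 1) *
      (1 - x) ^ (n + 1 - (m + 1) - 1) * (((n + 1 : ℕ) : ℝ) * x - ((m + 1 : ℕ) : ℝ)) =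
      (((m + 1 : ℕ) : ℝ) * ((n.choose (m + 1) : ℝ) * x ^ (m + 1) * (1 - x) ^ (n - (m + 1))) -
        (m : ℝ) * ((n.choose m : ℝ) * x ^ m * (1 - x) ^ (n - m))) -
        (n.choose m : ℝ) * x ^ m * (1 - x) ^ (n - m) := by
    intro m hm
    obtain ⟨r, rfl⟩ := Nat.exists_eq_add_of_lt (mem_range.1 hm)
    have hc : ((m + r + 1).choose (m + 1) : ℝ) * (m + 1) =
        ((m + r + 1).choose m : ℝ) * (r + 1) := by
      have h := Nat.choose_succ_right_eq (m + r + 1) m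
      rw [show m + r + 1 - m = r + 1 by omega] at h
      exact_mod_cast h
    rw [Nat.add_sub_cancel, show m + r + 1 + 1 - (m + 1) - 1 = r by omega,
      show m + r + 1 - (m + 1) = r by omega, show m + r + 1 - m = r + 1 by omega]
    push_cast
    linear_combination -(x ^ (m + 1) * (1 - x) ^ r) * hc
  rw [sum_congr rfl key, sum_sub_distrib,
    sum_range_sub fun m : ℕ => (m : ℝ) * ((n.choose m : ℝ) * x ^ m * (1 - x) ^ (n - m)),
    sum_range_bernstein_weight]
  simp
  ring

/-- For all `y > 0`, `Σ_{k=1}^{d−1} Σ_{j=1}^{d−1} δ_{r_k,r_j}(y)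
  = ((b−1)/b)·G_d(y)²·((b−1)·ε·ε̃/y² − (ε−ε̃)·x/y + x²)
    + 2·G_d(y)·((b−1)·ε·ε̃/y + ε̃·x) + d·x^d − d·x^(2d) + b·ε·ε̃`. -/
theorem double_sum_drr (b d : ℕ) (hb : 2 ≤ b) (hd : 2 ≤ d) (ε : ℝ)
    (hε0 : 0 < ε) (hε1 : ε < 1) (y : ℝ) (hy : 0 < y) :
    ∑ k ∈ Finset.Icc 1 (d - 1), ∑ j ∈ Finset.Icc 1 (d - 1), drr b d ε k j y =
      (((b : ℝ) - 1) / (b : ℝ)) * Gd b d ε y ^ 2 *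
          (((b : ℝ) - 1) * ε * (1 - ε) / y ^ 2 - (ε - (1 - ε)) * xx b ε y / y + xx b ε y ^ 2) +
        2 * Gd b d ε y * (((b : ℝ) - 1) * ε * (1 - ε) / y + (1 - ε) * xx b ε y) +
        (d : ℝ) * xx b ε y ^ d - (d : ℝ) * xx b ε y ^ (2 * d) +
        (b : ℝ) * ε * (1 - ε) := by
  obtain ⟨n, rfl⟩ : ∃ n, d = n + 1 := ⟨d - 1, by omega⟩
  have hn : 1 ≤ n := by omega
  have h1 : 1 ∈ Icc 1 n := mem_Icc.2 ⟨le_rfl, hn⟩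
  have hS := sum_G b n hn ε y
  have hP := sum_choose_mul_pow n (xx b ε y)
  have hQ := sum_mul_choose_mul_pow n (xx b ε y)
  have split : ∀ k ∈ Icc 1 n, ∀ j ∈ Icc 1 n, drr b (n + 1) ε k j y =
      (((b : ℝ) - 1) / (b : ℝ)) *
          (ε * (1 - ε) * ((b : ℝ) - 1) / y ^ 2 - (ε - (1 - ε)) * xx b ε y / y + xx b ε y ^ 2) *
          (G b (n + 1) ε k y * G b (n + 1) ε j y)
        - ((n + 1 : ℕ) : ℝ) *
          (((n.choose (k - 1) : ℝ) * xx b ε y ^ k * (1 - xx b ε y) ^ (n + 1 - k)) *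
            ((n.choose (j - 1) : ℝ) * xx b ε y ^ j * (1 - xx b ε y) ^ (n + 1 - j)))
        + (if k = j then (k : ℝ) * (n.choose (k - 1) : ℝ) * xx b ε y ^ k *
            (1 - xx b ε y) ^ (n + 1 - k) else 0)
        + ((b : ℝ) * ε * (1 - ε) - xx b ε y * (1 - xx b ε y)) *
          ((if k = 1 then (1 : ℝ) else 0) * (if j = 1 then (1 : ℝ) else 0))
        - (ε * (1 - ε) * ((b : ℝ) - 1) / y - ε * xx b ε y + xx b ε y ^ 2) *
          ((if k = 1 then (1 : ℝ) else 0) * G b (n + 1) ε j y)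
        - (ε * (1 - ε) * ((b : ℝ) - 1) / y - ε * xx b ε y + xx b ε y ^ 2) *
          (G b (n + 1) ε k y * (if j = 1 then (1 : ℝ) else 0)) := by
    intro k hk j hj
    rw [mem_Icc] at hk hj
    have he : 2 * (n + 1) - k - j = (n + 1 - k) + (n + 1 - j) := by omega
    rw [drr, he, pow_add, pow_add, Nat.add_sub_cancel, ite_and]
    split_ifs <;> ring
  rw [Nat.add_sub_cancel, sum_congr rfl fun k hk => sum_congr rfl (split k hk)]
  have hI : ∑ k ∈ Icc 1 n, (if k = 1 then (1 : ℝ) else 0) = 1 := by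
    rw [sum_ite_eq' (Icc 1 n) 1, if_pos h1]
  have hD : ∑ k ∈ Icc 1 n, ∑ j ∈ Icc 1 n, (if k = j then (k : ℝ) * (n.choose (k - 1) : ℝ) *
      xx b ε y ^ k * (1 - xx b ε y) ^ (n + 1 - k) else 0) =
      xx b ε y + n * xx b ε y ^ 2 - (n + 1) * xx b ε y ^ (n + 1) := by
    rw [← hQ]
    exact sum_congr rfl fun k hk => by rw [sum_ite_eq, if_pos hk]
  simp only [sum_sub_distrib, sum_add_distrib, ← mul_sum, ← sum_mul] at hD ⊢
  rw [hD, hS, hP, hI]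
  simp only [Gd, Nat.add_sub_cancel]
  push_cast
  ring
end

section
/- For all integers b ≥ 2 and d ≥ 2 and all real ε with 0 < ε < 1 (ε̃ = 1 − ε), the double sum of the initial covariances Σ_{j=1}^{d−1} Σ_{k=1}^{d−1} [ 1_{k=j}·j·C(d−1,j−1)·ε^j·ε̃^(d−j) − d·C(d−1,j−1)·C(d−1,k−1)·ε^(j+k)·ε̃^(2d−j−k) + (b−1)·C(d−1,j−1)·C(d−1,k−1)·ε^(j+k−1)·ε̃^(2d−j−k−1)·(d·ε − j)·(d·ε − k) ] equals b·ε·ε̃ − 2·b·d·ε^d·ε̃ + d·ε^d − d·ε^(2d) + (b−1)·d²·ε^(2d−1)·ε̃. -/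
open Finset

/-- The binomial weights `C(n, i) x ^ i (1 - x) ^ (n - i)` with `i < n` sum to `1 - x ^ n`. -/
theorem sum_range_binomial_weights (n : ℕ) (x : ℝ) :
    ∑ i ∈ range n, (n.choose i : ℝ) * x ^ i * (1 - x) ^ (n - i) = 1 - x ^ n := by
  have h := congrArg (Polynomial.eval x) (bernsteinPolynomial.sum ℝ n)
  simp only [Polynomial.eval_finsetSum, bernsteinPolynomial, Polynomial.eval_mul,
    Polynomial.eval_add, Polynomial.eval_pow, Polynomial.eval_sub, Polynomial.eval_X,
    Polynomial.eval_one,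
    Polynomial.eval_natCast, sum_range_succ, Nat.choose_self, Nat.sub_self, pow_zero,
    Nat.cast_one, one_mul, mul_one] at h
  linarith

/-- The first moment of the binomial weights `C(n, i) x ^ i (1 - x) ^ (n - i)` with `i < n`. -/
theorem sum_range_mul_binomial_weights (n : ℕ) (x : ℝ) :
    ∑ i ∈ range n, (i : ℝ) * ((n.choose i : ℝ) * x ^ i * (1 - x) ^ (n - i)) =
      n * x - n * x ^ n := by
  have h := congrArg (Polynomial.eval x) (bernsteinPolynomial.sum_smul ℝ n)
  simp only [Polynomial.eval_finsetSum, bernsteinPolynomial, Polynomial.eval_mul,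
    Polynomial.eval_add, Polynomial.eval_pow, Polynomial.eval_sub, Polynomial.eval_X,
    Polynomial.eval_one,
    Polynomial.eval_natCast, nsmul_eq_mul, sum_range_succ, Nat.choose_self, Nat.sub_self,
    pow_zero, Nat.cast_one, one_mul, mul_one] at h
  linarith

/-- For integers `b ≥ 2`, `d ≥ 2` and `0 < ε < 1` (`ε̃ = 1 − ε`), the double sum of the
initial covariances equals
`b·ε·ε̃ − 2·b·d·ε^d·ε̃ + d·ε^d − d·ε^(2d) + (b−1)·d²·ε^(2d−1)·ε̃`. -/
theorem double_sum_initial_covariances (b d : ℕ) (hb : 2 ≤ b) (hd : 2 ≤ d) (ε : ℝ)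
    (hε0 : 0 < ε) (hε1 : ε < 1) :
    ∑ j ∈ Finset.Icc 1 (d - 1), ∑ k ∈ Finset.Icc 1 (d - 1),
        ((if k = j then (1 : ℝ) else 0) * (j : ℝ) * (Nat.choose (d - 1) (j - 1) : ℝ) *
            ε ^ j * (1 - ε) ^ (d - j) -
          (d : ℝ) * (Nat.choose (d - 1) (j - 1) : ℝ) * (Nat.choose (d - 1) (k - 1) : ℝ) *
            ε ^ (j + k) * (1 - ε) ^ (2 * d - j - k) +
          ((b : ℝ) - 1) * (Nat.choose (d - 1) (j - 1) : ℝ) *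
            (Nat.choose (d - 1) (k - 1) : ℝ) * ε ^ (j + k - 1) *
            (1 - ε) ^ (2 * d - j - k - 1) * ((d : ℝ) * ε - (j : ℝ)) *
            ((d : ℝ) * ε - (k : ℝ))) =
      (b : ℝ) * ε * (1 - ε) - 2 * (b : ℝ) * (d : ℝ) * ε ^ d * (1 - ε) +
        (d : ℝ) * ε ^ d - (d : ℝ) * ε ^ (2 * d) +
        ((b : ℝ) - 1) * (d : ℝ) ^ 2 * ε ^ (2 * d - 1) * (1 - ε) := by
  obtain ⟨n, rfl⟩ : ∃ n, d = n + 1 := ⟨d - 1, by omega⟩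
  have hq : 1 - ε ≠ 0 := by linarith
  simp only [Nat.add_sub_cancel]
  have shift (f : ℕ → ℝ) : ∑ j ∈ Icc 1 n, f j = ∑ i ∈ range n, f (i + 1) := by
    rw [range_eq_Ico, sum_Ico_add' f 0 n 1]
    rfl
  simp only [shift, Nat.add_sub_cancel]
  set p : ℕ → ℝ := fun i => (n.choose i : ℝ) * ε ^ i * (1 - ε) ^ (n - i) with hp
  have hp0 : ∑ i ∈ range n, p i = 1 - ε ^ n := sum_range_binomial_weights n ε
  have hp1 : ∑ i ∈ range n, (i : ℝ) * p i = n * ε - n * ε ^ n :=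
    sum_range_mul_binomial_weights n ε
  have hterm : ∀ i ∈ range n, ∀ k ∈ range n,
      ((if k + 1 = i + 1 then (1 : ℝ) else 0) * ((i + 1 : ℕ) : ℝ) * (n.choose i : ℝ) *
            ε ^ (i + 1) * (1 - ε) ^ (n + 1 - (i + 1)) -
          ((n + 1 : ℕ) : ℝ) * (n.choose i : ℝ) * (n.choose k : ℝ) *
            ε ^ (i + 1 + (k + 1)) * (1 - ε) ^ (2 * (n + 1) - (i + 1) - (k + 1)) +
          ((b : ℝ) - 1) * (n.choose i : ℝ) * (n.choose k : ℝ) * ε ^ (i + 1 + (k + 1) - 1) *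
            (1 - ε) ^ (2 * (n + 1) - (i + 1) - (k + 1) - 1) *
            (((n + 1 : ℕ) : ℝ) * ε - ((i + 1 : ℕ) : ℝ)) *
            (((n + 1 : ℕ) : ℝ) * ε - ((k + 1 : ℕ) : ℝ))) =
      (if k = i then ε * (((i : ℝ) + 1) * p i) else 0) - ((n : ℝ) + 1) * ε ^ 2 * (p i * p k) +
        ((b : ℝ) - 1) * ε / (1 - ε) *
          ((p i * (((n : ℝ) + 1) * ε - (i + 1))) * (p k * (((n : ℝ) + 1) * ε - (k + 1)))) := by
    intro i hi k hk
    obtain ⟨r, hr⟩ : ∃ r, n = i + r + 1 := ⟨n - i - 1, by have := mem_range.1 hi; omega⟩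
    obtain ⟨s, hs⟩ : ∃ s, n = k + s + 1 := ⟨n - k - 1, by have := mem_range.1 hk; omega⟩
    have e1 : n + 1 - (i + 1) = r + 1 := by omega
    have e2 : 2 * (n + 1) - (i + 1) - (k + 1) = r + s + 2 := by omega
    have e3 : i + 1 + (k + 1) - 1 = i + k + 1 := by omega
    have e4 : r + s + 2 - 1 = r + s + 1 := by omega
    have e5 : n - i = r + 1 := by omega
    have e6 : n - k = s + 1 := by omega
    simp only [hp, e1, e2, e3, e4, e5, e6, Nat.add_right_cancel_iff]
    push_cast
    split_ifs <;> field_simp <;> ring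
  rw [sum_congr rfl fun i hi => sum_congr rfl (hterm i hi)]
  have hA : ∑ i ∈ range n, ((i : ℝ) + 1) * p i = n * ε - n * ε ^ n + (1 - ε ^ n) := by
    simp only [add_mul, one_mul, sum_add_distrib, hp0, hp1]
  have hB : ∑ i ∈ range n, p i * (((n : ℝ) + 1) * ε - (i + 1)) =
      (1 - ε) * ((n + 1) * ε ^ n - 1) := by
    have h : ∀ i ∈ range n, p i * (((n : ℝ) + 1) * ε - (i + 1)) =
        ((n : ℝ) + 1) * ε * p i - ((i : ℝ) + 1) * p i := fun i _ => by ring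
    rw [sum_congr rfl h, sum_sub_distrib, ← mul_sum, hp0, hA]
    ring
  have hdiag : ∑ i ∈ range n, ∑ k ∈ range n, (if k = i then ε * (((i : ℝ) + 1) * p i) else 0) =
      ε * ∑ i ∈ range n, ((i : ℝ) + 1) * p i := by
    rw [mul_sum]
    refine sum_congr rfl fun i hi => ?_
    rw [sum_ite_eq' (range n) i, if_pos hi]
  simp only [sum_add_distrib, sum_sub_distrib, hdiag, ← mul_sum, ← sum_mul, hp0, hA, hB]
  have e : 2 * (n + 1) - 1 = 2 * n + 1 := by omega
  rw [e]
  push_cast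
  field_simp
  ring
end

section
/- Suppose ε* ∈ (0,1) and y* ∈ (0,1]; set x* = ε*·(y*)^(b−1) and x̃* = 1 − x*. If ē_{r_1}(ε*, y*) = 0 and the partial derivative (∂/∂y) ē_{r_1}(ε*, y) vanishes at y = y*, where ē_{r_1}(ε, y) = ε·y^(b−1)·( y − 1 + (1 − ε·y^(b−1))^(d−1) ), then y* = 1 − (x̃*)^(d−1) and y* = (b−1)·(d−1)·x*·(x̃*)^(d−2). -/
/-- If `ε* ∈ (0,1)`, `y* ∈ (0,1]`, `x* = ε*·(y*)^(b−1)`, `ē_{r_1}(ε*, y*) = 0` and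
`(∂/∂y) ē_{r_1}(ε*, y)` vanishes at `y = y*`, where
`ē_{r_1}(ε, y) = ε·y^(b−1)·(y − 1 + (1 − ε·y^(b−1))^(d−1))`, then
`y* = 1 − (x̃*)^(d−1)` and `y* = (b−1)·(d−1)·x*·(x̃*)^(d−2)`. -/
theorem critical_point_equations (b d : ℕ) (hb : 2 ≤ b) (hd : 2 ≤ d)
    (εs ys : ℝ) (hε : εs ∈ Set.Ioo (0 : ℝ) 1) (hy : ys ∈ Set.Ioc (0 : ℝ) 1)
    (xs : ℝ) (hx : xs = εs * ys ^ (b - 1))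
    (h0 : εs * ys ^ (b - 1) * (ys - 1 + (1 - εs * ys ^ (b - 1)) ^ (d - 1)) = 0)
    (h1 : deriv (fun y : ℝ => εs * y ^ (b - 1) * (y - 1 + (1 - εs * y ^ (b - 1)) ^ (d - 1)))
        ys = 0) :
    ys = 1 - (1 - xs) ^ (d - 1) ∧
      ys = ((b : ℝ) - 1) * ((d : ℝ) - 1) * xs * (1 - xs) ^ (d - 2) := by
  obtain ⟨m, rfl⟩ := Nat.exists_eq_add_of_le' hb
  obtain ⟨n, rfl⟩ := Nat.exists_eq_add_of_le' hd
  have hm : m + 2 - 1 = m + 1 := rfl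
  have hn : n + 2 - 1 = n + 1 := rfl
  have hn' : n + 2 - 2 = n := rfl
  simp only [hm, hn, hn'] at *
  have hxne : εs * ys ^ (m + 1) ≠ 0 := (mul_pos hε.1 (pow_pos hy.1 _)).ne'
  have hbracket : ys - 1 + (1 - εs * ys ^ (m + 1)) ^ (n + 1) = 0 :=
    (mul_eq_zero.mp h0).resolve_left hxne
  have hpow : HasDerivAt (fun y : ℝ => εs * y ^ (m + 1)) (εs * ((m + 1 : ℝ) * ys ^ m)) ys := by
    simpa using (hasDerivAt_pow (m + 1) ys).const_mul εs
  have hsecond : HasDerivAt (fun y : ℝ => y - 1 + (1 - εs * y ^ (m + 1)) ^ (n + 1))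
      (1 + (n + 1 : ℝ) * (1 - εs * ys ^ (m + 1)) ^ n * -(εs * ((m + 1 : ℝ) * ys ^ m))) ys := by
    simpa using ((hasDerivAt_id' ys).sub_const 1).fun_add ((hpow.const_sub 1).fun_pow (n + 1))
  have hderiv := (hpow.mul hsecond).deriv.symm.trans h1
  rw [hbracket, mul_zero, zero_add] at hderiv
  have hcrit := (mul_eq_zero.mp hderiv).resolve_left hxne
  subst hx
  refine ⟨by linarith, ?_⟩
  push_cast
  linear_combination ys * hcrit
end

section
/- Suppose ε* ∈ (0,1), y* ∈ (0,1), x* = ε*·(y*)^(b−1) with 0 < x* < 1, and the critical-point equations y* = 1 − (1−x*)^(d−1) and y* = (b−1)·(d−1)·x*·(1−x*)^(d−2) hold. Then δ_{r_1,r_1}, evaluated with ε = ε*, y = y* (so x = x*), equals x*·y*·(y* − x*)/(b−1). -/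
open Finset Filter

/-- At the critical point, `G_1` equals `y·b/(b−1)`. -/
theorem G_one_at_critical_point {b d : ℕ} (hb : 2 ≤ b) (hd : 2 ≤ d) {ε y : ℝ}
    (h1 : y = 1 - (1 - xx b ε y) ^ (d - 1))
    (h2 : y = ((b : ℝ) - 1) * ((d : ℝ) - 1) * xx b ε y * (1 - xx b ε y) ^ (d - 2)) :
    G b d ε 1 y = y * b / ((b : ℝ) - 1) := by
  have hb' : (b : ℝ) - 1 ≠ 0 := by
    have : (2 : ℝ) ≤ b := by exact_mod_cast hb
    linarith
  obtain ⟨n, rfl⟩ := Nat.exists_eq_add_of_le' hd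
  simp only [G, Nat.sub_self, Nat.choose_zero_right, pow_zero, if_true, Nat.cast_one,
    show n + 2 - 1 - 1 = n from rfl]
  rw [show n + 2 - 1 = n + 1 from rfl, pow_succ] at h1
  rw [Nat.add_sub_cancel] at h2
  rw [eq_div_iff hb']
  linear_combination -h2 - ((b : ℝ) - 1) * h1

/-- At the critical point (`ε = ε*`, `y = y*`, `x* = ε*·(y*)^(b−1)` with
`y* = 1 − (1−x*)^(d−1)` and `y* = (b−1)·(d−1)·x*·(1−x*)^(d−2)`), the covariance
`δ_{r_1,r_1}` equals `x*·y*·(y* − x*)/(b−1)`. -/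
theorem drr_one_one_at_critical_point (b d : ℕ) (hb : 2 ≤ b) (hd : 2 ≤ d)
    (εs ys : ℝ) (hε : εs ∈ Set.Ioo (0 : ℝ) 1) (hy : ys ∈ Set.Ioo (0 : ℝ) 1)
    (xs : ℝ) (hx : xs = εs * ys ^ (b - 1)) (hx0 : 0 < xs) (hx1 : xs < 1)
    (h1 : ys = 1 - (1 - xs) ^ (d - 1))
    (h2 : ys = ((b : ℝ) - 1) * ((d : ℝ) - 1) * xs * (1 - xs) ^ (d - 2)) :
    drr b d εs 1 1 ys = xs * ys * (ys - xs) / ((b : ℝ) - 1) := by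
  have hb' : (2 : ℝ) ≤ b := by exact_mod_cast hb
  have hb1 : (b : ℝ) - 1 ≠ 0 := by linarith
  have hb0 : (b : ℝ) ≠ 0 := by linarith
  have hy0 : ys ≠ 0 := hy.1.ne'
  have hxx : xx b εs ys = xs := hx.symm
  have hG : G b d εs 1 ys = ys * b / ((b : ℝ) - 1) :=
    G_one_at_critical_point hb hd (by rwa [hxx]) (by rwa [hxx])
  have hq : (1 - xs) ^ (d - 1) = 1 - ys := by linarith
  have hpow : (1 - xs) ^ (2 * d - 1 - 1) = (1 - ys) ^ 2 := by
    rw [← hq, ← pow_mul]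
    congr 1
    omega
  have hdx : (d : ℝ) * xs * (1 - ys) = (1 - xs) * ys / ((b : ℝ) - 1) + xs * (1 - ys) := by
    have hs : (1 - xs) ^ (d - 2) * (1 - xs) = 1 - ys := by
      rw [← pow_succ, ← hq]
      congr 1
      omega
    rw [← sub_eq_iff_eq_add, eq_div_iff hb1]
    linear_combination (xs - 1) * h2 - ((b : ℝ) - 1) * ((d : ℝ) - 1) * xs * hs
  have hsq : (d : ℝ) * xs ^ 2 * (1 - ys) ^ 2 =
      xs * (1 - ys) * ((1 - xs) * ys / ((b : ℝ) - 1) + xs * (1 - ys)) := by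
    rw [← hdx]
    ring
  simp only [drr, hxx, hG, hq, hpow, Nat.sub_self, Nat.choose_zero_right, Nat.cast_one,
    and_self, if_true, mul_one, one_mul, pow_one, one_add_one_eq_two, hsq]
  field_simp
  ring
end

section
/- Suppose ε* ∈ (0,1), y* ∈ (0,1), x* = ε*·(y*)^(b−1), and the critical-point equations y* = 1 − (1−x*)^(d−1) and y* = (b−1)·(d−1)·x*·(1−x*)^(d−2) hold. Then the partial derivative (∂/∂ε) ē_{r_1}(ε, y*) evaluated at ε = ε* equals −x*·y*/( ε*·(b−1) ), where ē_{r_1}(ε, y) = ε·y^(b−1)·( y − 1 + (1 − ε·y^(b−1))^(d−1) ). -/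
/-- At the critical point, the partial derivative `(∂/∂ε) ē_{r_1}(ε, y*)` at `ε = ε*`
equals `−x*·y*/(ε*·(b−1))`, where
`ē_{r_1}(ε, y) = ε·y^(b−1)·(y − 1 + (1 − ε·y^(b−1))^(d−1))`. -/
theorem deriv_er_one_in_eps_at_critical_point (b d : ℕ) (hb : 2 ≤ b) (hd : 2 ≤ d)
    (εs ys : ℝ) (hε : εs ∈ Set.Ioo (0 : ℝ) 1) (hy : ys ∈ Set.Ioo (0 : ℝ) 1)
    (xs : ℝ) (hx : xs = εs * ys ^ (b - 1))
    (h1 : ys = 1 - (1 - xs) ^ (d - 1))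
    (h2 : ys = ((b : ℝ) - 1) * ((d : ℝ) - 1) * xs * (1 - xs) ^ (d - 2)) :
    deriv (fun ε : ℝ => ε * ys ^ (b - 1) * (ys - 1 + (1 - ε * ys ^ (b - 1)) ^ (d - 1))) εs =
      -(xs * ys) / (εs * ((b : ℝ) - 1)) := by
  have hb' : (b : ℝ) - 1 ≠ 0 := by
    have : (2 : ℝ) ≤ b := by exact_mod_cast hb
    linarith
  have hε0 : εs ≠ 0 := hε.1.ne'
  obtain ⟨k, rfl⟩ := Nat.exists_eq_add_of_le' hd
  simp only [Nat.add_sub_cancel, show k + 2 - 1 = k + 1 from rfl] at h1 h2 ⊢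
  generalize ys ^ (b - 1) = c at hx ⊢
  have hlin : HasDerivAt (fun ε : ℝ => ε * c) c εs := by
    simpa using (hasDerivAt_id εs).mul_const c
  have hprod := hlin.mul (((hlin.const_sub 1).pow (k + 1)).const_add (ys - 1))
  refine hprod.deriv.trans ?_
  simp only [Pi.pow_apply, ← hx, Nat.add_sub_cancel]
  have hzero : ys - 1 + (1 - xs) ^ (k + 1) = 0 := by linarith
  rw [hzero, eq_div_iff (mul_ne_zero hε0 hb')]
  push_cast at h2 ⊢
  linear_combination (-c * εs) * -h2 + ys * hx
end

section
/- Assume b ≥ 3. Then for every j ∈ {1,…,d−1}, the one-sided limits as y → 0+ satisfy lim_{y→0+} δ_{l,r_j}(y) = b·ε·ε̃·1_{j=1} and lim_{y→0+} δ_{r_j,r_j}(y) = b·ε·ε̃·1_{j=1}. -/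
open Finset Filter

open Polynomial in
/-- `G_j` is `x` times a continuous function of `y`. -/
lemma exists_continuous_G_eq_mul (b d : ℕ) (ε : ℝ) (j : ℕ) (hj1 : 1 ≤ j) :
    ∃ Q : ℝ → ℝ, Continuous Q ∧ ∀ y, G b d ε j y = xx b ε y * Q y := by
  let p : ℝ[X] := C (Nat.choose (d - 1) (j - 1) : ℝ) * X ^ (j - 1) *
      (1 - X) ^ (d - j - 1) * (C (d : ℝ) * X - C (j : ℝ)) + C (if j = 1 then (1 : ℝ) else 0)
  have hp0 : p.eval 0 = 0 := by
    rcases hj1.eq_or_lt with rfl | hj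
    · simp [p]
    · have h1 : j ≠ 1 := by omega
      have h2 : j - 1 ≠ 0 := by omega
      simp [p, h1, h2]
  obtain ⟨q, hq⟩ : X ∣ p := by
    rwa [X_dvd_iff, coeff_zero_eq_eval_zero]
  refine ⟨fun y => q.eval (xx b ε y), ?_, fun y => ?_⟩
  · unfold xx
    fun_prop
  · have h := congrArg (eval (xx b ε y)) hq
    rw [eval_mul, eval_X] at h
    rw [← h]
    simp only [p, G, eval_add, eval_mul, eval_pow, eval_sub, eval_C, eval_X, eval_one]

lemma xx_eq_sq_mul {b : ℕ} (hb : 3 ≤ b) (ε y : ℝ) : xx b ε y = y ^ 2 * (ε * y ^ (b - 3)) := by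
  rw [xx, show b - 1 = 2 + (b - 3) by omega, pow_add]
  ring

lemma tendsto_nhdsGT_zero_of_eq {f g : ℝ → ℝ} {a : ℝ} (hg : Continuous g) (h0 : g 0 = a)
    (h : ∀ y, 0 < y → f y = g y) : Tendsto f (nhdsWithin 0 (Set.Ioi 0)) (nhds a) := by
  rw [← h0]
  refine (hg.continuousWithinAt (s := Set.Ioi 0) (x := 0)).tendsto.congr' ?_
  filter_upwards [self_mem_nhdsWithin] with y hy using (h y hy).symm

/-- For `b ≥ 3` and `j ∈ {1,…,d−1}`, as `y → 0⁺`,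
`δ_{l,r_j}(y) → b·ε·ε̃·1_{j=1}` and `δ_{r_j,r_j}(y) → b·ε·ε̃·1_{j=1}`. -/
theorem limits_at_zero_b_ge_three (b d : ℕ) (hb : 3 ≤ b) (hd : 2 ≤ d) (ε : ℝ)
    (hε0 : 0 < ε) (hε1 : ε < 1) (j : ℕ) (hj1 : 1 ≤ j) (hj2 : j ≤ d - 1) :
    Filter.Tendsto (dlr b d ε j) (nhdsWithin 0 (Set.Ioi 0))
        (nhds ((b : ℝ) * ε * (1 - ε) * (if j = 1 then (1 : ℝ) else 0))) ∧
      Filter.Tendsto (drr b d ε j j) (nhdsWithin 0 (Set.Ioi 0))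
        (nhds ((b : ℝ) * ε * (1 - ε) * (if j = 1 then (1 : ℝ) else 0))) := by
  obtain ⟨Q, hQ, hGQ⟩ := exists_continuous_G_eq_mul b d ε j hj1
  set R : ℝ → ℝ := fun y => ε * y ^ (b - 3) * Q y with hR
  have hRc : Continuous R := by fun_prop
  have hG (y : ℝ) : G b d ε j y = y ^ 2 * R y := by
    rw [hGQ, xx_eq_sq_mul hb, hR]
    ring
  have hxc : Continuous (xx b ε) := by
    unfold xx
    fun_prop
  have hx0 : xx b ε 0 = 0 := by simp [xx_eq_sq_mul hb]
  have hj0 : j ≠ 0 := by omega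
  constructor
  · refine tendsto_nhdsGT_zero_of_eq
      (g := fun y => -(y * R y) * (ε * (1 - ε) * ((b : ℝ) - 1) + (1 - ε) * xx b ε y * y) +
        (if j = 1 then (1 : ℝ) else 0) * ((b : ℝ) * ε * (1 - ε))) (by fun_prop) ?_ ?_
    · simp
    · intro y hy
      simp only [dlr, hG]
      field_simp
  · refine tendsto_nhdsGT_zero_of_eq
      (g := fun y => (((b : ℝ) - 1) / (b : ℝ)) * R y ^ 2 *
          (ε * (1 - ε) * ((b : ℝ) - 1) * y ^ 2 - (ε - (1 - ε)) * xx b ε y * y ^ 3 +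
            xx b ε y ^ 2 * y ^ 4)
        - (d : ℝ) * (Nat.choose (d - 1) (j - 1) : ℝ) * (Nat.choose (d - 1) (j - 1) : ℝ) *
          xx b ε y ^ (j + j) * (1 - xx b ε y) ^ (2 * d - j - j)
        + (j : ℝ) * (Nat.choose (d - 1) (j - 1) : ℝ) * xx b ε y ^ j * (1 - xx b ε y) ^ (d - j)
        + (if j = 1 then (1 : ℝ) else 0) *
          ((b : ℝ) * ε * (1 - ε) - xx b ε y * (1 - xx b ε y))
        - 2 * (if j = 1 then (1 : ℝ) else 0) * (y * R y) *
          (ε * (1 - ε) * ((b : ℝ) - 1) - ε * xx b ε y * y + xx b ε y ^ 2 * y))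
      (by fun_prop) ?_ ?_
    · simp [hx0, hj0]
    · intro y hy
      have hb0 : (b : ℝ) ≠ 0 := by positivity
      simp only [drr, hG, and_self, if_true]
      have h1 : (((b : ℝ) - 1) / (b : ℝ)) * (y ^ 2 * R y) * (y ^ 2 * R y) *
          (ε * (1 - ε) * ((b : ℝ) - 1) / y ^ 2 - (ε - (1 - ε)) * xx b ε y / y + xx b ε y ^ 2) =
          (((b : ℝ) - 1) / (b : ℝ)) * R y ^ 2 *
          (ε * (1 - ε) * ((b : ℝ) - 1) * y ^ 2 - (ε - (1 - ε)) * xx b ε y * y ^ 3 +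
            xx b ε y ^ 2 * y ^ 4) := by
        field_simp
      have h2 : y ^ 2 * R y *
          (ε * (1 - ε) * ((b : ℝ) - 1) / y - ε * xx b ε y + xx b ε y ^ 2) =
          y * R y * (ε * (1 - ε) * ((b : ℝ) - 1) - ε * xx b ε y * y + xx b ε y ^ 2 * y) := by
        field_simp
      rw [h1]
      linear_combination -2 * (if j = 1 then (1 : ℝ) else 0) * h2
end

section
/- Assume b = 2 and d ≥ 3. Then, as y → 0+: lim δ_{l,r_1}(y) = 2·ε·ε̃·(1 − (d−1)·ε), lim δ_{l,r_2}(y) = 2·ε·ε̃·(d−1)·ε, and lim δ_{l,r_j}(y) = 0 for j ∈ {3,…,d−1}; moreover lim δ_{r_1,r_1}(y) = 2·ε·ε̃·(1 − (d−1)·ε)², lim δ_{r_1,r_2}(y) = lim δ_{r_2,r_1}(y) = 2·ε²·ε̃·(d−1)·(1 − (d−1)·ε), lim δ_{r_2,r_2}(y) = 2·ε·ε̃·(d−1)²·ε², and lim δ_{r_k,r_j}(y) = 0 for all other pairs (k,j) with k,j ∈ {1,…,d−1}. -/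
open Finset Filter

/-- The derivative at `0` of `G_j` for `b = 2`. -/
lemma hasDerivAt_G_two_zero (d j : ℕ) (ε : ℝ) :
    HasDerivAt (G 2 d ε j)
      ((d - 1).choose (j - 1) * ((j - 1 : ℕ) * 0 ^ (j - 1 - 1) * ε * -(j : ℝ) +
        0 ^ (j - 1) * ((d - j - 1 : ℕ) * ε * j + d * ε))) 0 := by
  have hx : HasDerivAt (xx 2 ε) ε 0 := by
    have h := (hasDerivAt_id (0 : ℝ)).const_mul ε
    simp only [mul_one] at h
    exact h.congr_of_eventuallyEq (.of_forall fun y => by simp [xx])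
  have h0 : xx 2 ε 0 = 0 := by simp [xx]
  have h := ((((hx.pow (j - 1)).const_mul ((d - 1).choose (j - 1) : ℝ)).mul
    ((hx.const_sub 1).pow (d - j - 1))).mul ((hx.const_mul (d : ℝ)).sub_const (j : ℝ))).add_const
    (if j = 1 then (1 : ℝ) else 0)
  refine (h.congr_deriv ?_).congr_of_eventuallyEq (.of_forall fun y => ?_)
  · simp only [Pi.mul_apply, Pi.pow_apply, h0, sub_zero, one_pow]
    ring
  · simp [G]

lemma tendsto_div_of_hasDerivAt_zero {f : ℝ → ℝ} {g : ℝ} (h : HasDerivAt f g 0) (h0 : f 0 = 0) :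
    Tendsto (fun y => f y / y) (nhdsWithin 0 (Set.Ioi 0)) (nhds g) := by
  have h' := h.tendsto_slope_zero_right
  simpa [h0, div_eq_inv_mul] using h'

lemma G_two_zero (d ε) {j : ℕ} (hj : 1 ≤ j) : G 2 d ε j 0 = 0 := by
  obtain rfl | h : j = 1 ∨ 2 ≤ j := by omega
  · simp [G, xx]
  · have : j - 1 ≠ 0 := by omega
    have h1 : j ≠ 1 := by omega
    simp [G, xx, this, h1]

/-- The limit of `δ_{l,r_j}` in terms of that of `G_j(y) / y`. -/
lemma tendsto_dlr_two {d j : ℕ} {ε g : ℝ}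
    (hg : Tendsto (fun y => G 2 d ε j y / y) (nhdsWithin 0 (Set.Ioi 0)) (nhds g)) :
    Tendsto (dlr 2 d ε j) (nhdsWithin 0 (Set.Ioi 0))
      (nhds (ε * (1 - ε) * ((if j = 1 then 2 else 0) - g))) := by
  have hy : Tendsto (fun y : ℝ => y) (nhdsWithin 0 (Set.Ioi 0)) (nhds 0) := nhdsWithin_le_nhds
  have h := ((hg.neg.mul (((hy.pow 2).const_mul ((1 - ε) * ε)).const_add (ε * (1 - ε)))).add_const
    ((if j = 1 then (1 : ℝ) else 0) * (2 * ε * (1 - ε))))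
  refine (h.congr' ?_).trans_eq (congrArg nhds ?_)
  · filter_upwards [self_mem_nhdsWithin] with y hy
    have hy : y ≠ 0 := ne_of_gt hy
    simp only [dlr, xx]
    push_cast
    field_simp
    ring
  · split_ifs <;> ring

/-- The limit of `δ_{r_k,r_j}` in terms of those of `G_k(y) / y` and `G_j(y) / y`. -/
lemma tendsto_drr_two {d k j : ℕ} {ε g g' : ℝ} (hk : 1 ≤ k)
    (hg : Tendsto (fun y => G 2 d ε k y / y) (nhdsWithin 0 (Set.Ioi 0)) (nhds g))
    (hg' : Tendsto (fun y => G 2 d ε j y / y) (nhdsWithin 0 (Set.Ioi 0)) (nhds g')) :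
    Tendsto (drr 2 d ε k j) (nhdsWithin 0 (Set.Ioi 0))
      (nhds (ε * (1 - ε) * (g * g' / 2 + (if k = 1 ∧ j = 1 then 2 else 0) -
        ((if k = 1 then 1 else 0) * g' + (if j = 1 then 1 else 0) * g)))) := by
  have hy : Tendsto (fun y : ℝ => y) (nhdsWithin 0 (Set.Ioi 0)) (nhds 0) := nhdsWithin_le_nhds
  let F : ℝ × ℝ × ℝ → ℝ := fun p =>
    1 / 2 * p.1 * p.2.1 * (ε * (1 - ε) - (ε - (1 - ε)) * ε * p.2.2 ^ 2 + ε ^ 2 * p.2.2 ^ 4)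
    - (d : ℝ) * (Nat.choose (d - 1) (k - 1) : ℝ) * (Nat.choose (d - 1) (j - 1) : ℝ) *
        (ε * p.2.2) ^ (k + j) * (1 - ε * p.2.2) ^ (2 * d - k - j)
    + (if k = j then (1 : ℝ) else 0) * (k : ℝ) * (Nat.choose (d - 1) (k - 1) : ℝ) *
        (ε * p.2.2) ^ k * (1 - ε * p.2.2) ^ (d - k)
    + (if k = 1 ∧ j = 1 then (1 : ℝ) else 0) *
        (2 * ε * (1 - ε) - ε * p.2.2 * (1 - ε * p.2.2))
    - ((if k = 1 then (1 : ℝ) else 0) * p.2.1 + (if j = 1 then (1 : ℝ) else 0) * p.1) *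
        (ε * (1 - ε) - ε ^ 2 * p.2.2 ^ 2 + ε ^ 2 * p.2.2 ^ 3)
  have hF : Continuous F := by fun_prop
  have h := (hF.tendsto (g, g', 0)).comp (hg.prodMk_nhds (hg'.prodMk_nhds hy))
  refine (h.congr' ?_).trans_eq (congrArg nhds ?_)
  · filter_upwards [self_mem_nhdsWithin] with y hy
    have hy : y ≠ 0 := ne_of_gt hy
    simp only [drr, xx, F, Function.comp]
    generalize G 2 d ε k y = a
    generalize G 2 d ε j y = c
    have e1 : 1 / 2 * (a / y) * (c / y) *
        (ε * (1 - ε) - (ε - (1 - ε)) * ε * y ^ 2 + ε ^ 2 * y ^ 4) =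
        (((2 : ℕ) : ℝ) - 1) / ((2 : ℕ) : ℝ) * a * c * (ε * (1 - ε) * (((2 : ℕ) : ℝ) - 1) / y ^ 2 -
          (ε - (1 - ε)) * (ε * y ^ (2 - 1)) / y + (ε * y ^ (2 - 1)) ^ 2) := by
      push_cast
      field_simp
      ring
    have e2 (s t : ℝ) : (s * (c / y) + t * (a / y)) *
        (ε * (1 - ε) - ε ^ 2 * y ^ 2 + ε ^ 2 * y ^ 3) =
        (s * c + t * a) * (ε * (1 - ε) * (((2 : ℕ) : ℝ) - 1) / y -
          ε * (ε * y ^ (2 - 1)) + (ε * y ^ (2 - 1)) ^ 2) := by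
      push_cast
      field_simp
      ring
    rw [e1, e2]
    simp
  · have h1 : k ≠ 0 := by omega
    simp only [F, mul_zero, ne_eq, h1, not_false_eq_true, zero_pow, Nat.add_eq_zero_iff,
      false_and, OfNat.ofNat_ne_zero, zero_mul, sub_zero, add_zero]
    split_ifs <;> ring

/-- For `b = 2` and `d ≥ 3`, the one-sided limits as `y → 0⁺` of `δ_{l,r_j}` and
`δ_{r_k,r_j}` are as stated in the paper. -/
theorem limits_at_zero_b_eq_two (d : ℕ) (hd : 3 ≤ d) (ε : ℝ)
    (hε0 : 0 < ε) (hε1 : ε < 1) :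
    Filter.Tendsto (dlr 2 d ε 1) (nhdsWithin 0 (Set.Ioi 0))
        (nhds (2 * ε * (1 - ε) * (1 - ((d : ℝ) - 1) * ε))) ∧
      Filter.Tendsto (dlr 2 d ε 2) (nhdsWithin 0 (Set.Ioi 0))
        (nhds (2 * ε * (1 - ε) * (((d : ℝ) - 1) * ε))) ∧
      (∀ j : ℕ, 3 ≤ j → j ≤ d - 1 →
        Filter.Tendsto (dlr 2 d ε j) (nhdsWithin 0 (Set.Ioi 0)) (nhds 0)) ∧
      Filter.Tendsto (drr 2 d ε 1 1) (nhdsWithin 0 (Set.Ioi 0))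
        (nhds (2 * ε * (1 - ε) * (1 - ((d : ℝ) - 1) * ε) ^ 2)) ∧
      Filter.Tendsto (drr 2 d ε 1 2) (nhdsWithin 0 (Set.Ioi 0))
        (nhds (2 * ε ^ 2 * (1 - ε) * ((d : ℝ) - 1) * (1 - ((d : ℝ) - 1) * ε))) ∧
      Filter.Tendsto (drr 2 d ε 2 1) (nhdsWithin 0 (Set.Ioi 0))
        (nhds (2 * ε ^ 2 * (1 - ε) * ((d : ℝ) - 1) * (1 - ((d : ℝ) - 1) * ε))) ∧
      Filter.Tendsto (drr 2 d ε 2 2) (nhdsWithin 0 (Set.Ioi 0))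
        (nhds (2 * ε * (1 - ε) * ((d : ℝ) - 1) ^ 2 * ε ^ 2)) ∧
      (∀ k j : ℕ, 1 ≤ k → k ≤ d - 1 → 1 ≤ j → j ≤ d - 1 → ¬(k ≤ 2 ∧ j ≤ 2) →
        Filter.Tendsto (drr 2 d ε k j) (nhdsWithin 0 (Set.Ioi 0)) (nhds 0)) := by
  have H {j : ℕ} (hj : 1 ≤ j) :=
    tendsto_div_of_hasDerivAt_zero (hasDerivAt_G_two_zero d j ε) (G_two_zero d ε hj)
  have H1 : Tendsto (fun y => G 2 d ε 1 y / y) (nhdsWithin 0 (Set.Ioi 0))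
      (nhds (2 * (d - 1) * ε)) := by
    convert H le_rfl using 2
    have h : ((d - 1 - 1 : ℕ) : ℝ) = d - 2 := by
      rw [Nat.sub_sub, Nat.cast_sub (by omega)]
      norm_num
    simp [h]
    ring
  have H2 : Tendsto (fun y => G 2 d ε 2 y / y) (nhdsWithin 0 (Set.Ioi 0))
      (nhds (-2 * (d - 1) * ε)) := by
    convert H one_le_two using 2
    simp [Nat.cast_sub (show 1 ≤ d by omega)]
    ring
  have H3 {j : ℕ} (hj : 3 ≤ j) : Tendsto (fun y => G 2 d ε j y / y) (nhdsWithin 0 (Set.Ioi 0))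
      (nhds 0) := by
    convert H (show 1 ≤ j by omega) using 2
    simp [show j - 1 - 1 ≠ 0 by omega, show j - 1 ≠ 0 by omega]
  refine ⟨?_, ?_, fun j hj _ => ?_, ?_, ?_, ?_, ?_, fun k j hk _ hj _ hkj => ?_⟩
  · convert tendsto_dlr_two H1 using 2
    simp
    ring
  · convert tendsto_dlr_two H2 using 2
    simp
    ring
  · convert tendsto_dlr_two (H3 hj) using 2
    simp [show j ≠ 1 by omega]
  · convert tendsto_drr_two le_rfl H1 H1 using 2
    simp
    ring
  · convert tendsto_drr_two le_rfl H1 H2 using 2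
    simp
    ring
  · convert tendsto_drr_two one_le_two H2 H1 using 2
    simp
    ring
  · convert tendsto_drr_two one_le_two H2 H2 using 2
    simp
    ring
  · obtain h | h : 3 ≤ k ∨ 3 ≤ j := by omega
    · convert tendsto_drr_two hk (H3 h) (H hj) using 2
      simp [show k ≠ 1 by omega]
    · convert tendsto_drr_two hk (H hk) (H3 h) using 2
      simp [show j ≠ 1 by omega]
end

section
/- (Relation to the stability condition.) Define ρ(ε) = lim_{y→0+} δ_{l,r_1}(y) / sqrt( δ_{l,l} · δ_{r_1,r_1}(y) ), where δ_{l,l} = b·ε·ε̃. If b ≥ 3, then ρ(ε) = 1 for all ε ∈ (0,1). If b = 2, then ρ(ε) = 1 whenever (d−1)·ε < 1, and ρ(ε) = −1 whenever (d−1)·ε > 1; in other words, ρ(ε) = 1 exactly when the stability condition 1_{b=2}·(d−1)·ε ≤ 1 holds strictly (for b = 2) or automatically (for b ≥ 3). -/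
open Finset Filter

/-- The slope of `G_1` at the origin is `2·(d−1)·ε` if `b = 2` and `0` if `b ≥ 3`. -/
theorem tendsto_G_one_div (b d : ℕ) (hb : 2 ≤ b) (hd : 2 ≤ d) (ε : ℝ) :
    Tendsto (fun y => G b d ε 1 y / y) (nhdsWithin 0 (Set.Ioi 0))
      (nhds (2 * ((d : ℝ) - 1) * (ε * 0 ^ (b - 2)))) := by
  obtain ⟨m, rfl⟩ := Nat.exists_eq_add_of_le' hb
  obtain ⟨n, rfl⟩ := Nat.exists_eq_add_of_le' hd
  have hx : HasDerivAt (xx (m + 2) ε) (ε * 0 ^ m) 0 := by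
    have h := (hasDerivAt_pow (m + 1) (0 : ℝ)).const_mul ε
    refine h.congr_deriv ?_
    rcases m with _ | m <;> simp
  have hx0 : xx (m + 2) ε 0 = 0 := by simp [xx]
  have hG : HasDerivAt (G (m + 2) (n + 2) ε 1)
      (2 * (((n + 2 : ℕ) : ℝ) - 1) * (ε * 0 ^ m)) 0 := by
    have h := (((hx.const_sub 1).pow n).mul
      ((hx.const_mul (((n + 2 : ℕ) : ℝ))).sub_const 1)).add_const 1
    have hfun : G (m + 2) (n + 2) ε 1 = fun y => (1 - xx (m + 2) ε y) ^ n *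
        (((n + 2 : ℕ) : ℝ) * xx (m + 2) ε y - 1) + 1 := by
      funext y
      simp [G]
    rw [hfun]
    refine h.congr_deriv ?_
    simp only [Pi.pow_apply, hx0]
    push_cast
    ring
  have hG0 : G (m + 2) (n + 2) ε 1 0 = 0 := by simp [G, hx0]
  refine hG.tendsto_slope_zero_right.congr fun y => ?_
  simp [hG0, div_eq_inv_mul]

theorem tendsto_xx (b : ℕ) (hb : 2 ≤ b) (ε : ℝ) :
    Tendsto (xx b ε) (nhdsWithin 0 (Set.Ioi 0)) (nhds 0) := by
  have hc : Continuous (xx b ε) := by unfold xx; fun_prop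
  have h0 : xx b ε 0 = 0 := by simp [xx, show b - 1 ≠ 0 by omega]
  simpa only [h0] using (hc.tendsto 0).mono_left nhdsWithin_le_nhds

theorem tendsto_dlr_one (b d : ℕ) (hb : 2 ≤ b) (ε g : ℝ)
    (hg : Tendsto (fun y => G b d ε 1 y / y) (nhdsWithin 0 (Set.Ioi 0)) (nhds g)) :
    Tendsto (dlr b d ε 1) (nhdsWithin 0 (Set.Ioi 0))
      (nhds (ε * (1 - ε) * ((b : ℝ) - ((b : ℝ) - 1) * g))) := by
  have hy : Tendsto (fun y : ℝ => y) (nhdsWithin 0 (Set.Ioi 0)) (nhds 0) := nhdsWithin_le_nhds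
  have hp : Continuous fun p : ℝ × ℝ × ℝ =>
      -p.1 * (ε * (1 - ε) * ((b : ℝ) - 1) + (1 - ε) * p.2.1 * p.2.2) + b * ε * (1 - ε) := by
    fun_prop
  have h := (hp.tendsto (g, 0, 0)).comp
    (hg.prodMk_nhds ((tendsto_xx b hb ε).prodMk_nhds hy))
  convert h.congr' ?_ using 2
  · ring
  · filter_upwards [self_mem_nhdsWithin] with y (hy0 : 0 < y)
    simp only [dlr, Function.comp_apply, if_true]
    field_simp

theorem tendsto_drr_one (b d : ℕ) (hb : 2 ≤ b) (ε g : ℝ)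
    (hg : Tendsto (fun y => G b d ε 1 y / y) (nhdsWithin 0 (Set.Ioi 0)) (nhds g)) :
    Tendsto (drr b d ε 1 1) (nhdsWithin 0 (Set.Ioi 0))
      (nhds (ε * (1 - ε) / b * ((b : ℝ) - ((b : ℝ) - 1) * g) ^ 2)) := by
  have hy : Tendsto (fun y : ℝ => y) (nhdsWithin 0 (Set.Ioi 0)) (nhds 0) := nhdsWithin_le_nhds
  have hb0 : (b : ℝ) ≠ 0 := by positivity
  have hp : Continuous fun p : ℝ × ℝ × ℝ =>
      (((b : ℝ) - 1) / b) * p.1 ^ 2 *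
          (ε * (1 - ε) * ((b : ℝ) - 1) - (ε - (1 - ε)) * p.2.1 * p.2.2 + p.2.1 ^ 2 * p.2.2 ^ 2)
        - d * p.2.1 ^ 2 * (1 - p.2.1) ^ (2 * d - 1 - 1)
        + p.2.1 * (1 - p.2.1) ^ (d - 1)
        + (b * ε * (1 - ε) - p.2.1 * (1 - p.2.1))
        - 2 * p.1 * (ε * (1 - ε) * ((b : ℝ) - 1) + (-ε * p.2.1 + p.2.1 ^ 2) * p.2.2) := by
    fun_prop
  have h := (hp.tendsto (g, 0, 0)).comp
    (hg.prodMk_nhds ((tendsto_xx b hb ε).prodMk_nhds hy))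
  convert h.congr' ?_ using 2
  · field_simp
    ring
  · filter_upwards [self_mem_nhdsWithin] with y (hy0 : 0 < y)
    have hG : G b d ε 1 y = G b d ε 1 y / y * y := by field_simp
    simp only [drr, Function.comp_apply]
    rw [hG, mul_div_cancel_right₀ _ hy0.ne']
    generalize G b d ε 1 y / y = u
    generalize xx b ε y = x
    simp
    field_simp
    ring

/-- The limit of the correlation coefficient is the sign of `b − (b−1)·g`, where `g` is the slope of
`G_1` at the origin. -/
theorem tendsto_correlation (b d : ℕ) (hb : 2 ≤ b) (ε g : ℝ)
    (hε0 : 0 < ε) (hε1 : ε < 1)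
    (hg : Tendsto (fun y => G b d ε 1 y / y) (nhdsWithin 0 (Set.Ioi 0)) (nhds g))
    (hne : (b : ℝ) - ((b : ℝ) - 1) * g ≠ 0) :
    Tendsto (fun y => dlr b d ε 1 y / Real.sqrt ((b : ℝ) * ε * (1 - ε) * drr b d ε 1 1 y))
      (nhdsWithin 0 (Set.Ioi 0))
      (nhds (((b : ℝ) - ((b : ℝ) - 1) * g) / |(b : ℝ) - ((b : ℝ) - 1) * g|)) := by
  have hb0 : (b : ℝ) ≠ 0 := by positivity
  have hc : 0 < ε * (1 - ε) := mul_pos hε0 (sub_pos.2 hε1)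
  have hs := ((tendsto_drr_one b d hb ε g hg).const_mul ((b : ℝ) * ε * (1 - ε))).sqrt
  have hval : Real.sqrt ((b : ℝ) * ε * (1 - ε) *
      (ε * (1 - ε) / b * ((b : ℝ) - ((b : ℝ) - 1) * g) ^ 2)) =
      ε * (1 - ε) * |(b : ℝ) - ((b : ℝ) - 1) * g| := by
    rw [← Real.sqrt_sq (mul_nonneg hc.le (abs_nonneg _)), mul_pow _ |_|, sq_abs]
    congr 1
    field_simp
  rw [hval] at hs
  have h := (tendsto_dlr_one b d hb ε g hg).div hs (mul_ne_zero hc.ne' (abs_ne_zero.2 hne))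
  rwa [mul_div_mul_left _ _ hc.ne'] at h

/-- Relation to the stability condition: the correlation coefficient
`ρ(ε) = lim_{y→0⁺} δ_{l,r_1}(y)/sqrt(δ_{l,l}·δ_{r_1,r_1}(y))` (with `δ_{l,l} = b·ε·ε̃`)
equals `1` if `b ≥ 3`; for `b = 2` it equals `1` when `(d−1)·ε < 1` and `−1` when
`(d−1)·ε > 1`, i.e. `ρ(ε) = 1` exactly when the stability condition
`1_{b=2}·(d−1)·ε ≤ 1` holds strictly (for `b = 2`) or automatically (for `b ≥ 3`). -/
theorem correlation_coefficient_stability (b d : ℕ) (hb : 2 ≤ b) (hd : 2 ≤ d) (ε : ℝ)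
    (hε0 : 0 < ε) (hε1 : ε < 1) :
    (3 ≤ b →
      Filter.Tendsto
        (fun y => dlr b d ε 1 y / Real.sqrt ((b : ℝ) * ε * (1 - ε) * drr b d ε 1 1 y))
        (nhdsWithin 0 (Set.Ioi 0)) (nhds 1)) ∧
    (b = 2 → ((d : ℝ) - 1) * ε < 1 →
      Filter.Tendsto
        (fun y => dlr b d ε 1 y / Real.sqrt ((b : ℝ) * ε * (1 - ε) * drr b d ε 1 1 y))
        (nhdsWithin 0 (Set.Ioi 0)) (nhds 1)) ∧
    (b = 2 → 1 < ((d : ℝ) - 1) * ε →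
      Filter.Tendsto
        (fun y => dlr b d ε 1 y / Real.sqrt ((b : ℝ) * ε * (1 - ε) * drr b d ε 1 1 y))
        (nhdsWithin 0 (Set.Ioi 0)) (nhds (-1))) := by
  have key := fun hne => tendsto_correlation b d hb ε _ hε0 hε1
    (tendsto_G_one_div b d hb hd ε) hne
  refine ⟨fun h3 => ?_, ?_, ?_⟩
  · have hb0 : (0 : ℝ) < b := by positivity
    simp only [zero_pow (show b - 2 ≠ 0 by omega), mul_zero, sub_zero, abs_of_pos hb0,
      div_self hb0.ne'] at key
    exact key hb0.ne'
  · rintro rfl h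
    have hpos : (0 : ℝ) < (2 : ℕ) -
        (((2 : ℕ) : ℝ) - 1) * (2 * ((d : ℝ) - 1) * (ε * 0 ^ (2 - 2))) := by
      norm_num
      linarith
    rw [abs_of_pos hpos, div_self hpos.ne'] at key
    exact key hpos.ne'
  · rintro rfl h
    have hneg : (2 : ℕ) -
        (((2 : ℕ) : ℝ) - 1) * (2 * ((d : ℝ) - 1) * (ε * 0 ^ (2 - 2))) < (0 : ℝ) := by
      norm_num
      linarith
    rw [abs_of_neg hneg, div_neg, div_self hneg.ne] at key
    exact key hneg.ne
end
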